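/- Let G=(V,E) be a finite simple graph with at least three ℛ₂-components. Then G has at least three ℛ₂-components each of which has at most two vertices of attachment, where the vertices of attachment of a subgraph H of G are the vertices of H having a neighbour in V∖V(H). -/

import Mathlib

open scoped BigOperators

noncomputable section

namespace Rigidity

variable {V : Type*}

/-- Euclidean distance between two points of `ℝ^d` (given as coordinate functions). -/
def eDist {d : ℕ} (x y : Fin d → ℝ) : ℝ := Real.sqrt (∑ i, (x i - y i) ^ 2)

/-- Two frameworks `(G,p)` and `(G,q)` are equivalent if corresponding edge lengths agree. -/
def Equivalent {d : ℕ} (G : SimpleGraph V) (p q : V → Fin d → ℝ) : Prop :=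
  ∀ u v : V, G.Adj u v → eDist (p u) (p v) = eDist (q u) (q v)

/-- Two placements are congruent if all pairwise distances agree. -/
def Congruent {d : ℕ} (p q : V → Fin d → ℝ) : Prop :=
  ∀ u v : V, eDist (p u) (p v) = eDist (q u) (q v)

/-- A placement is generic if the multiset of its coordinates is algebraically
independent over `ℚ`. -/
def Generic {d : ℕ} (p : V → Fin d → ℝ) : Prop :=
  AlgebraicIndependent ℚ (fun vi : V × Fin d => p vi.1 vi.2)

/-- `{u,v}` is globally linked in the framework `(G,p)`. -/
def GloballyLinkedIn {d : ℕ} (G : SimpleGraph V) (p : V → Fin d → ℝ) (u v : V) : Prop :=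
  ∀ q : V → Fin d → ℝ, Equivalent G p q → eDist (q u) (q v) = eDist (p u) (p v)

/-- `{u,v}` is globally `d`-linked in `G`. -/
def GloballyLinked (d : ℕ) (G : SimpleGraph V) (u v : V) : Prop :=
  ∀ p : V → Fin d → ℝ, Generic p → GloballyLinkedIn G p u v

/-- The framework `(G,p)` is rigid. -/
def RigidFramework {d : ℕ} (G : SimpleGraph V) (p : V → Fin d → ℝ) : Prop :=
  ∃ ε > (0:ℝ), ∀ q : V → Fin d → ℝ, Equivalent G p q →
    (∀ v, eDist (p v) (q v) < ε) → Congruent p q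

/-- `G` is `d`-rigid: every generic framework of `G` in `ℝ^d` is rigid. -/
def IsRigidGraph (d : ℕ) (G : SimpleGraph V) : Prop :=
  ∀ p : V → Fin d → ℝ, Generic p → RigidFramework G p

/-- The framework `(G,p)` is globally rigid. -/
def GloballyRigidFramework {d : ℕ} (G : SimpleGraph V) (p : V → Fin d → ℝ) : Prop :=
  ∀ q : V → Fin d → ℝ, Equivalent G p q → Congruent p q

/-- The row of the rigidity matrix corresponding to the (ordered) edge `(u,v)`. -/
def edgeVec [DecidableEq V] {d : ℕ} (p : V → Fin d → ℝ) (u v : V) : V × Fin d → ℝ :=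
  fun wi => if wi.1 = u then p u wi.2 - p v wi.2
            else if wi.1 = v then p v wi.2 - p u wi.2 else 0

/-- The rank of the set of rows of the rigidity matrix of `(·,p)` indexed by `F`. -/
def rankAt [DecidableEq V] (d : ℕ) (p : V → Fin d → ℝ) (F : Set (Sym2 V)) : ℕ :=
  Module.finrank ℝ (Submodule.span ℝ
    {x : V × Fin d → ℝ | ∃ u v : V, s(u, v) ∈ F ∧ x = edgeVec p u v})

/-- `r_d(F)`: the rank of the set of rows indexed by `F` of the rigidity matrix of a
generic framework, equivalently the maximum of this rank over all placements. -/
def rd [DecidableEq V] (d : ℕ) (F : Set (Sym2 V)) : ℕ :=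
  sSup {n : ℕ | ∃ p : V → Fin d → ℝ, n = rankAt d p F}

/-- An edge set is `ℛ_d`-independent if its rank equals its cardinality. -/
def RdIndep [DecidableEq V] (d : ℕ) (F : Set (Sym2 V)) : Prop := rd d F = F.ncard

/-- An `ℛ_d`-circuit: not independent, but every proper subset is independent. -/
def RdCircuit [DecidableEq V] (d : ℕ) (C : Set (Sym2 V)) : Prop :=
  ¬ RdIndep d C ∧ ∀ C' : Set (Sym2 V), C' ⊂ C → RdIndep d C'

/-- An `ℛ_d`-circuit of the graph `G`. -/
def RdCircuitOf [DecidableEq V] (d : ℕ) (G : SimpleGraph V) (C : Set (Sym2 V)) : Prop :=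
  C ⊆ G.edgeSet ∧ RdCircuit d C

/-- `F` is (the edge set of) an `ℛ_d`-component of `G`: an equivalence class of the
relation "`e = f` or some `ℛ_d`-circuit of `G` contains both `e` and `f`". -/
def IsRdComponent [DecidableEq V] (d : ℕ) (G : SimpleGraph V) (F : Set (Sym2 V)) : Prop :=
  ∃ e ∈ G.edgeSet, F = {f | f ∈ G.edgeSet ∧
    (e = f ∨ ∃ C, RdCircuitOf d G C ∧ e ∈ C ∧ f ∈ C)}

/-- The set of vertices covered by an edge set. -/
def vertexSpan (F : Set (Sym2 V)) : Set V := {v | ∃ e ∈ F, v ∈ e}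

/-- A nonempty edge set is `ℛ_d`-connected if any two of its edges lie on a common
`ℛ_d`-circuit contained in it (or are equal). -/
def RdConnectedSet [DecidableEq V] (d : ℕ) (F : Set (Sym2 V)) : Prop :=
  F.Nonempty ∧ ∀ e ∈ F, ∀ f ∈ F, e = f ∨ ∃ C, C ⊆ F ∧ RdCircuit d C ∧ e ∈ C ∧ f ∈ C

/-- A graph (with at least one edge) is `ℛ_d`-connected. -/
def RdConnected [DecidableEq V] (d : ℕ) (H : SimpleGraph V) : Prop :=
  RdConnectedSet d H.edgeSet

/-- `e` is an `ℛ_d`-bridge of `G`: `r_d(E ∖ {e}) = r_d(E) − 1`. -/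
def IsRdBridge [DecidableEq V] (d : ℕ) (G : SimpleGraph V) (e : Sym2 V) : Prop :=
  e ∈ G.edgeSet ∧ rd d (G.edgeSet \ {e}) + 1 = rd d G.edgeSet

/-- `G + uv`. -/
def addEdge (G : SimpleGraph V) (u v : V) : SimpleGraph V :=
  G ⊔ SimpleGraph.fromEdgeSet {s(u, v)}

/-- `{u,v}` is `d`-linked in `G` if `r_d(G+uv) = r_d(G)`. -/
def IsLinked [DecidableEq V] (d : ℕ) (G : SimpleGraph V) (u v : V) : Prop :=
  rd d (addEdge G u v).edgeSet = rd d G.edgeSet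

/-- There exist `k` pairwise internally vertex-disjoint `u`–`v` paths in `H`
(i.e. `κ_H(u,v) ≥ k`). -/
def InternallyDisjointPaths (H : SimpleGraph V) (u v : V) (k : ℕ) : Prop :=
  ∃ P : Fin k → H.Walk u v, (∀ i, (P i).IsPath) ∧
    ∀ i j, i ≠ j → ∀ w, w ∈ (P i).support → w ∈ (P j).support → w = u ∨ w = v

/-- An unordered pair forming a 2-separator: two distinct vertices whose deletion
disconnects the graph. -/
def TwoSepPair (H : SimpleGraph V) (e : Sym2 V) : Prop :=
  ¬ e.IsDiag ∧ ¬ (H.induce {v | v ∉ e}).Connected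

/-- The augmented graph `Ĥ`: add an edge for every 2-separator. -/
def aug (H : SimpleGraph V) : SimpleGraph V :=
  H ⊔ SimpleGraph.fromEdgeSet {e | TwoSepPair H e}

/-- A subgraph is 3-connected: at least 4 vertices, and deleting fewer than 3
vertices leaves it connected. -/
def IsThreeConnectedSubgraph {G : SimpleGraph V} (J : G.Subgraph) : Prop :=
  4 ≤ J.verts.ncard ∧ ∀ S : Set V, S.ncard < 3 → (J.deleteVerts S).coe.Connected

/-- A 3-block of `H`: a maximal 3-connected subgraph of the augmented graph `Ĥ`. -/
def IsThreeBlock (H : SimpleGraph V) (J : (aug H).Subgraph) : Prop :=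
  IsThreeConnectedSubgraph J ∧
    ∀ J' : (aug H).Subgraph, IsThreeConnectedSubgraph J' → J ≤ J' → J = J'

/-- `h_H(e)`: the number of 3-blocks of `H` containing both vertices of `e`. -/
def numBlocksOn (H : SimpleGraph V) (e : Sym2 V) : ℕ :=
  {J : (aug H).Subgraph | IsThreeBlock H J ∧ ∀ v ∈ e, v ∈ J.verts}.ncard

open Classical in
/-- `k(H) = Σ (h_H(ab) − 1)` over all 2-separators `{a,b}` of `H`. -/
def kGraph [Fintype V] [DecidableEq V] (H : SimpleGraph V) : ℕ :=
  ∑ e : Sym2 V, if TwoSepPair H e then numBlocksOn H e - 1 else 0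

/-- The graph of an `ℛ₂`-component, on its own vertex set. -/
def componentGraph [DecidableEq V] (F : Set (Sym2 V)) :
    SimpleGraph (vertexSpan F) :=
  (SimpleGraph.fromEdgeSet F).induce (vertexSpan F)

/-- `X` is the vertex set of an `ℛ_d`-block of `G`: a 3-block of a non-trivial
`ℛ_d`-component of `G`. -/
def IsRdBlockVerts [DecidableEq V] (d : ℕ) (G : SimpleGraph V) (X : Set V) : Prop :=
  ∃ F : Set (Sym2 V), IsRdComponent d G F ∧ 2 ≤ F.ncard ∧
    ∃ J : (aug (componentGraph F)).Subgraph,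
      IsThreeBlock (componentGraph F) J ∧ X = Subtype.val '' J.verts

/-- The globally linked closure of `G` in `ℝ^d`. -/
def glc (d : ℕ) (G : SimpleGraph V) : SimpleGraph V :=
  G ⊔ SimpleGraph.fromEdgeSet {e | ∃ u v : V, e = s(u, v) ∧ GloballyLinked d G u v}

/-- A globally `d`-linked cluster: the vertex set of a maximal complete subgraph of
`glc_d(G)`. -/
def IsCluster (d : ℕ) (G : SimpleGraph V) (X : Set V) : Prop :=
  (∀ a ∈ X, ∀ b ∈ X, a ≠ b → (glc d G).Adj a b) ∧
    ∀ Y : Set V, X ⊆ Y → (∀ a ∈ Y, ∀ b ∈ Y, a ≠ b → (glc d G).Adj a b) → Y = X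

/-- Equilibrium stress of a framework, encoded as a symmetric function vanishing on
non-edges. -/
def IsEqStress [Fintype V] {d : ℕ} (G : SimpleGraph V) (p : V → Fin d → ℝ)
    (ω : V → V → ℝ) : Prop :=
  (∀ u v, ω u v = ω v u) ∧ (∀ u v, ¬ G.Adj u v → ω u v = 0) ∧
    ∀ u, ∑ v, ω u v • (p u - p v) = 0

/-- `{u,v}` is `d`-stress-linked in `G`. -/
def StressLinked [Fintype V] (d : ℕ) (G : SimpleGraph V) (u v : V) : Prop :=
  ∀ p : V → Fin d → ℝ, Generic p → ∀ q : V → Fin d → ℝ,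
    (∀ ω, IsEqStress G p ω → IsEqStress G q ω) →
    ∀ ω, IsEqStress (addEdge G u v) p ω → IsEqStress (addEdge G u v) q ω

/-- Equivalence of complex frameworks. -/
def CEquivalent {d : ℕ} (G : SimpleGraph V) (p q : V → Fin d → ℂ) : Prop :=
  ∀ u v : V, G.Adj u v →
    ∑ i, (p u i - p v i) ^ 2 = ∑ i, (q u i - q v i) ^ 2

/-- Generic complex placement. -/
def CGeneric {d : ℕ} (p : V → Fin d → ℂ) : Prop :=
  AlgebraicIndependent ℚ (fun vi : V × Fin d => p vi.1 vi.2)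

/-- `{u,v}` is globally linked in `G` in `ℂ^d`. -/
def CGloballyLinked (d : ℕ) (G : SimpleGraph V) (u v : V) : Prop :=
  ∀ p : V → Fin d → ℂ, CGeneric p → ∀ q : V → Fin d → ℂ, CEquivalent G p q →
    ∑ i, (q u i - q v i) ^ 2 = ∑ i, (p u i - p v i) ^ 2

/-- A flexing of the framework `(G,q)`. -/
def IsFlexing {d : ℕ} (G : SimpleGraph V) (q : V → Fin d → ℝ)
    (φ : Set.Icc (0:ℝ) 1 → V → Fin d → ℝ) : Prop :=
  Continuous φ ∧ φ ⟨0, Set.left_mem_Icc.mpr zero_le_one⟩ = q ∧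
    (∀ t, Equivalent G q (φ t)) ∧
    ∀ t : Set.Icc (0:ℝ) 1, 0 < (t : ℝ) → ¬ Congruent q (φ t)

/-- A finite loopless multigraph on vertex type `V` with edge type `E`. -/
structure Multigraph (V : Type*) (E : Type*) where
  ends : E → Sym2 V
  loopless : ∀ e, ¬ (ends e).IsDiag

/-- The data `(B, bar)` exhibits `G` as a body-bar graph induced by `H`. -/
def IsBodyBar {V E W : Type*} (H : Multigraph V E) (G : SimpleGraph W)
    (B : V → Set W) (bar : E → W × W) : Prop :=
  (∀ w : W, ∃! v : V, w ∈ B v) ∧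
  (∀ v : V, (B v).ncard = {e : E | v ∈ H.ends e}.ncard) ∧
  (∀ e : E, ∃ w z : V, H.ends e = s(w, z) ∧ (bar e).1 ∈ B w ∧ (bar e).2 ∈ B z) ∧
  (∀ e : E, (bar e).1 ≠ (bar e).2) ∧
  (∀ e e' : E, e ≠ e' →
    ({(bar e).1, (bar e).2} ∩ {(bar e').1, (bar e').2} : Set W) = ∅) ∧
  (∀ a b : W, G.Adj a b ↔ a ≠ b ∧
    ((∃ v : V, a ∈ B v ∧ b ∈ B v) ∨ ∃ e : E, s(a, b) = s((bar e).1, (bar e).2)))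

/-- `P` is a partition of the set `X`. -/
def IsPartitionOf {V : Type*} (X : Set V) (P : Set (Set V)) : Prop :=
  (∀ p ∈ P, p.Nonempty ∧ p ⊆ X) ∧ ∀ v ∈ X, ∃! p, p ∈ P ∧ v ∈ p

/-- The subgraph `(X,F)` of the multigraph `H` is `k`-tree-connected. -/
def SubTreeConnected {V E : Type*} (k : ℕ) (H : Multigraph V E)
    (X : Set V) (F : Set E) : Prop :=
  X.Nonempty ∧ (∀ e ∈ F, ∀ v ∈ H.ends e, v ∈ X) ∧
    ∀ P : Set (Set V), IsPartitionOf X P →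
      k * (P.ncard - 1) ≤ {e | e ∈ F ∧ ¬ ∃ p ∈ P, ∀ v ∈ H.ends e, v ∈ p}.ncard

/-- `(X,F)` is a `k`-superbrick of `H`: a maximal `k`-tree-connected subgraph. -/
def IsSuperbrick {V E : Type*} (k : ℕ) (H : Multigraph V E)
    (X : Set V) (F : Set E) : Prop :=
  SubTreeConnected k H X F ∧
    ∀ X' F', SubTreeConnected k H X' F' → X ⊆ X' → F ⊆ F' → X = X' ∧ F = F'

section Incidence

variable {ι : Type*} [DecidableEq V]

/-- The vertices of `W i` lying in some other member of the family. -/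
def sharedVerts [DecidableEq ι] (I : Finset ι) (W : ι → Finset V) (i : ι) : Finset V :=
  (W i).filter fun v => ∃ j ∈ I, j ≠ i ∧ v ∈ W j

/-- The number of members of the subfamily `S` containing `v`. -/
def multiplicity (S : Finset ι) (W : ι → Finset V) (v : V) : ℕ :=
  (S.filter fun i => v ∈ W i).card

lemma sum_card_eq_sum_multiplicity [Fintype V] (S : Finset ι) (W : ι → Finset V) :
    ∑ i ∈ S, (W i).card = ∑ v, multiplicity S W v := by
  simp only [multiplicity, Finset.card_filter]
  rw [Finset.sum_comm]
  refine Finset.sum_congr rfl fun i _ => ?_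
  simp

lemma card_biUnion_eq_sum_multiplicity [Fintype V] (S : Finset ι) (W : ι → Finset V) :
    (S.biUnion W).card = ∑ v, if 1 ≤ multiplicity S W v then 1 else 0 := by
  rw [← Finset.card_filter]
  congr 1
  ext v
  simp [multiplicity, Nat.one_le_iff_ne_zero, Finset.filter_eq_empty_iff]

lemma two_le_multiplicity_iff [DecidableEq ι] {I : Finset ι} {W : ι → Finset V}
    {i : ι} (hi : i ∈ I) {v : V} (hv : v ∈ W i) : 2 ≤ multiplicity I W v ↔ ∃ j ∈ I, j ≠ i ∧ v ∈ W j := by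
  unfold multiplicity
  have : i ∈ I.filter fun i => v ∈ W i := by simp [hi, hv]
  rw [← Finset.card_erase_add_one this, Nat.succ_le_succ_iff, Finset.one_le_card]
  constructor
  · rintro ⟨j, hj⟩
    simp only [Finset.mem_erase, Finset.mem_filter] at hj
    exact ⟨j, hj.2.1, hj.1, hj.2.2⟩
  · rintro ⟨j, h1, h2, h3⟩
    exact ⟨j, by simp [*]⟩

lemma sum_card_sharedVerts [DecidableEq ι] [Fintype V] {I S : Finset ι} (hS : S ⊆ I)
    (W : ι → Finset V) :
    ∑ i ∈ S, (sharedVerts I W i).card =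
      ∑ v, if 2 ≤ multiplicity I W v then multiplicity S W v else 0 := by
  have h : ∀ i ∈ S, (sharedVerts I W i).card =
      ∑ v, if v ∈ W i then (if 2 ≤ multiplicity I W v then 1 else 0) else 0 := by
    intro i hi
    rw [sharedVerts, Finset.card_filter, Finset.sum_ite_mem, Finset.univ_inter]
    exact Finset.sum_congr rfl fun v hv =>
      if_congr (two_le_multiplicity_iff (hS hi) hv).symm rfl rfl
  rw [Finset.sum_congr rfl h, Finset.sum_comm]
  refine Finset.sum_congr rfl fun v _ => ?_
  split_ifs with h2
  · rw [multiplicity, Finset.card_filter]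
  · simp

lemma sum_card_sharedVerts_le [DecidableEq ι] [Fintype V] {I S : Finset ι} (hS : S ⊆ I)
    (W : ι → Finset V)
    (hW : ∑ i ∈ S, (2 * ((W i).card : ℤ) - 3) ≤ 2 * ((S.biUnion W).card : ℤ) - 3) :
    ∑ i ∈ S, ((sharedVerts I W i).card : ℤ) ≤
      3 * S.card - 3 + ∑ i ∈ I \ S, ((sharedVerts I W i).card : ℤ) := by
  have key : ∑ i ∈ S, (sharedVerts I W i).card + 2 * (S.biUnion W).card ≤
      2 * ∑ i ∈ S, (W i).card + ∑ i ∈ I \ S, (sharedVerts I W i).card := by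
    rw [sum_card_sharedVerts hS, sum_card_sharedVerts Finset.sdiff_subset,
      sum_card_eq_sum_multiplicity, card_biUnion_eq_sum_multiplicity, Finset.mul_sum,
      Finset.mul_sum, ← Finset.sum_add_distrib, ← Finset.sum_add_distrib]
    refine Finset.sum_le_sum fun v _ => ?_
    have : multiplicity I W v = multiplicity S W v + multiplicity (I \ S) W v := by
      unfold multiplicity
      rw [← Finset.card_union_of_disjoint, ← Finset.filter_union,
        Finset.union_sdiff_of_subset hS]
      exact Finset.disjoint_filter_filter Finset.disjoint_sdiff
    split_ifs <;> omega
  rw [Finset.sum_sub_distrib, ← Finset.mul_sum] at hW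
  simp only [Finset.sum_const, nsmul_eq_mul] at hW
  zify at key
  linarith

/-- A family of at least three sets whose subfamilies all satisfy the count
`∑ (2|W i| - 3) ≤ 2|⋃ W i| - 3` has three members with at most two shared elements. -/
lemma three_le_card_filter_sharedVerts [DecidableEq ι] [Fintype V]
    (I : Finset ι) (W : ι → Finset V) (hI : 3 ≤ I.card)
    (hW : ∀ S ⊆ I, S.Nonempty →
      ∑ i ∈ S, (2 * ((W i).card : ℤ) - 3) ≤ 2 * ((S.biUnion W).card : ℤ) - 3) :
    3 ≤ (I.filter fun i => (sharedVerts I W i).card ≤ 2).card := by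
  by_contra! hlt
  set T := I.filter fun i => (sharedVerts I W i).card ≤ 2 with hT
  have hTI : T ⊆ I := Finset.filter_subset _ _
  have hbig : ∀ R ⊆ I, 3 * ((R \ T).card : ℤ) ≤ ∑ i ∈ R \ T, ((sharedVerts I W i).card : ℤ) := by
    intro R hR
    have := Finset.card_nsmul_le_sum (R \ T) (fun i => ((sharedVerts I W i).card : ℤ)) 3
      (fun i hi => by
        simp only [hT, Finset.mem_sdiff, Finset.mem_filter, not_and, not_le] at hi
        have := hi.2 (hR hi.1)
        omega)
    simpa [mul_comm] using this
  have hcardI : I.card = (I \ T).card + T.card := by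
    rw [Finset.card_sdiff_of_subset hTI]; have := Finset.card_le_card hTI; omega
  have hsplit : ∑ i ∈ I, ((sharedVerts I W i).card : ℤ) =
      ∑ i ∈ I \ T, ((sharedVerts I W i).card : ℤ) + ∑ i ∈ T, ((sharedVerts I W i).card : ℤ) :=
    (Finset.sum_sdiff hTI).symm
  have hne : (I \ T).Nonempty := by rw [← Finset.card_pos]; omega
  have h1 := sum_card_sharedVerts_le Finset.sdiff_subset W (hW (I \ T) Finset.sdiff_subset hne)
  rw [Finset.sdiff_sdiff_eq_self hTI] at h1
  have h2 := sum_card_sharedVerts_le (Finset.Subset.refl I) W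
    (hW I (Finset.Subset.refl I) (by rw [← Finset.card_pos]; omega))
  rw [Finset.sdiff_self, Finset.sum_empty] at h2
  have h3 := hbig I (Finset.Subset.refl I)
  have hT2 : T.card = 2 := by zify at *; omega
  obtain ⟨x, y, hxy, hTxy⟩ := Finset.card_eq_two.1 hT2
  have hsum : ∑ i ∈ T, ((sharedVerts I W i).card : ℤ) =
      (sharedVerts I W x).card + (sharedVerts I W y).card := by
    rw [hTxy, Finset.sum_pair hxy]
  have hremove : ∀ z w, z ≠ w → T = {z, w} → (sharedVerts I W z).card ≤ 1 →
      2 ≤ (sharedVerts I W w).card → False := by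
    intro z w hzw hzwT hz hw
    have hzI : z ∈ I := hTI (by simp [hzwT])
    have h4 := sum_card_sharedVerts_le (S := I.erase z) (Finset.erase_subset _ _) W
      (hW _ (Finset.erase_subset _ _) ⟨w, by simp [hzw.symm, hTI (show w ∈ T by simp [hzwT])]⟩)
    have h5 : I \ I.erase z = {z} := by
      ext i; simp only [Finset.mem_sdiff, Finset.mem_erase, Finset.mem_singleton]
      constructor
      · intro h; by_contra h'; exact h.2 ⟨h', h.1⟩
      · rintro rfl; simp [hzI]
    have h6 : ∑ i ∈ I, ((sharedVerts I W i).card : ℤ) =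
        (sharedVerts I W z).card + ∑ i ∈ I.erase z, ((sharedVerts I W i).card : ℤ) :=
      (Finset.add_sum_erase _ _ hzI).symm
    have h7 : ∑ i ∈ T, ((sharedVerts I W i).card : ℤ) =
      (sharedVerts I W z).card + (sharedVerts I W w).card := by
      rw [hzwT, Finset.sum_pair hzw]
    rw [h5, Finset.sum_singleton, Finset.card_erase_of_mem hzI] at h4
    omega
  have hx : x ∈ T := by simp [hTxy]
  have hy : y ∈ T := by simp [hTxy]
  simp only [hT, Finset.mem_filter] at hx hy
  rcases Nat.lt_or_ge 1 (sharedVerts I W x).card with h | h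
  · exact hremove y x hxy.symm (by rw [hTxy, Finset.pair_comm]) (by omega) (by omega)
  · exact hremove x y hxy hTxy (by omega) (by omega)

end Incidence

/-- Sharing a circuit is transitive in a finite matroid. -/
lemma exists_isCircuit_mem_mem {α : Type*} [Finite α] {M : Matroid α} {C₁ C₂ : Set α} {e g : α}
    (h₁ : M.IsCircuit C₁) (h₂ : M.IsCircuit C₂) (he : e ∈ C₁) (hg : g ∈ C₂)
    (h : (C₁ ∩ C₂).Nonempty) : ∃ C ⊆ C₁ ∪ C₂, M.IsCircuit C ∧ e ∈ C ∧ g ∈ C := by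
  induction hn : (C₁ ∪ C₂).ncard using Nat.strong_induction_on generalizing C₁ C₂ with
  | _ n ih =>
  by_contra! hno
  obtain ⟨f, hf₁, hf₂⟩ := h
  have heC₂ : e ∉ C₂ := fun h' => hno C₂ Set.subset_union_right h₂ h' hg
  have hgC₁ : g ∉ C₁ := fun h' => hno C₁ Set.subset_union_left h₁ he h'
  obtain ⟨C₃, hC₃s, hC₃, heC₃⟩ := h₁.strong_elimination h₂ hf₁ hf₂ he heC₂
  obtain ⟨C₄, hC₄s, hC₄, hgC₄⟩ := h₂.strong_elimination h₁ hf₂ hf₁ hg hgC₁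
  rw [Set.union_comm] at hC₄s
  have hfU : f ∈ C₁ ∪ C₂ := Or.inl hf₁
  have hlt : ∀ X ⊆ C₁ ∪ C₂, ∀ x ∈ C₁ ∪ C₂, x ∉ X → X.ncard < n := fun X hX x hx hxX =>
    hn ▸ Set.ncard_lt_ncard ⟨hX, fun h' => hxX (h' hx)⟩ (Set.toFinite _)
  have hC₃U : C₃ ⊆ C₁ ∪ C₂ := hC₃s.trans Set.sdiff_subset
  have hC₄U : C₄ ⊆ C₁ ∪ C₂ := hC₄s.trans Set.sdiff_subset
  have hmeet : (C₃ ∩ C₂).Nonempty := by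
    by_contra hemp
    have : C₃ ⊆ C₁ := fun x hx => (hC₃U hx).resolve_right fun hx' => hemp ⟨x, hx, hx'⟩
    exact (hC₃s ((hC₃.eq_of_subset_isCircuit h₁ this).symm ▸ hf₁)).2 rfl
  have hmeet' : ((C₁ \ C₂) ∩ C₄).Nonempty := by
    by_contra hemp
    have : C₄ ⊆ C₂ := fun x hx => by
      by_contra hx'
      exact hemp ⟨x, ⟨(hC₄U hx).resolve_right hx', hx'⟩, hx⟩
    exact (hC₄s ((hC₄.eq_of_subset_isCircuit h₂ this).symm ▸ hf₂)).2 rfl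
  have hsub : C₁ \ C₂ ⊆ C₃ := by
    by_contra hns
    obtain ⟨x, hx, hx₃⟩ := Set.not_subset.1 hns
    have hU : C₃ ∪ C₂ ⊆ C₁ ∪ C₂ := Set.union_subset hC₃U Set.subset_union_right
    obtain ⟨C, hC, hC', h1, h2⟩ := ih _
      (hlt _ hU x (Or.inl hx.1) (by simp [hx₃, hx.2])) hC₃ h₂ heC₃ hg hmeet rfl
    exact hno C (hC.trans hU) hC' h1 h2
  have hU : C₃ ∪ C₄ ⊆ C₁ ∪ C₂ := Set.union_subset hC₃U hC₄U
  obtain ⟨C, hC, hC', h1, h2⟩ := ih _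
    (hlt _ hU f hfU (by
      rintro (hh | hh)
      · exact (hC₃s hh).2 rfl
      · exact (hC₄s hh).2 rfl)) hC₃ hC₄ heC₃ hgC₄
      (hmeet'.mono fun x hx => ⟨hsub hx.1, hx.2⟩) rfl
  exact hno C (hC.trans hU) hC' h1 h2

section Rows

variable [DecidableEq V] {d : ℕ}

lemma edgeVec_comm (p : V → Fin d → ℝ) (u v : V) : edgeVec p u v = edgeVec p v u := by
  funext wi
  unfold edgeVec
  split_ifs <;> simp_all

/-- The row of the rigidity matrix corresponding to an unordered pair. -/
def row (p : V → Fin d → ℝ) : Sym2 V → V × Fin d → ℝ :=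
  Sym2.lift ⟨edgeVec p, edgeVec_comm p⟩

lemma row_mk (p : V → Fin d → ℝ) (u v : V) : row p s(u, v) = edgeVec p u v := rfl

lemma rankAt_eq_finrank (p : V → Fin d → ℝ) (F : Set (Sym2 V)) :
    rankAt d p F = Set.finrank ℝ (Set.range fun e : F => row p e) := by
  unfold rankAt Set.finrank
  have : {x : V × Fin d → ℝ | ∃ u v : V, s(u, v) ∈ F ∧ x = edgeVec p u v} =
      Set.range fun e : F => row p e := by
    ext x
    constructor
    · rintro ⟨u, v, h, rfl⟩
      exact ⟨⟨s(u, v), h⟩, rfl⟩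
    · rintro ⟨⟨e, he⟩, rfl⟩
      induction e with | h u v => exact ⟨u, v, he, rfl⟩
  rw [this]

variable [Fintype V]

lemma rankAt_le_ncard (p : V → Fin d → ℝ) (F : Set (Sym2 V)) : rankAt d p F ≤ F.ncard := by
  classical
  rw [rankAt_eq_finrank, ← Nat.card_coe_set_eq, Nat.card_eq_fintype_card]
  exact finrank_range_le_card _

lemma linearIndepOn_row_iff (p : V → Fin d → ℝ) (F : Set (Sym2 V)) :
    LinearIndepOn ℝ (row p) F ↔ rankAt d p F = F.ncard := by
  classical
  rw [LinearIndepOn, linearIndependent_iff_card_eq_finrank_span, rankAt_eq_finrank,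
    ← Nat.card_coe_set_eq, Nat.card_eq_fintype_card, eq_comm]

lemma rdIndep_iff {F : Set (Sym2 V)} :
    RdIndep d F ↔ ∃ p : V → Fin d → ℝ, LinearIndepOn ℝ (row p) F := by
  have hbdd : BddAbove {n : ℕ | ∃ p : V → Fin d → ℝ, n = rankAt d p F} :=
    ⟨F.ncard, by rintro _ ⟨p, rfl⟩; exact rankAt_le_ncard p F⟩
  have hne : {n : ℕ | ∃ p : V → Fin d → ℝ, n = rankAt d p F}.Nonempty := ⟨_, 0, rfl⟩
  simp only [linearIndepOn_row_iff, RdIndep, rd]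
  constructor
  · intro h
    obtain ⟨p, hp⟩ := Nat.sSup_mem hne hbdd
    exact ⟨p, hp ▸ h⟩
  · rintro ⟨p, hp⟩
    refine le_antisymm (csSup_le hne ?_) (le_csSup hbdd ⟨p, hp.symm⟩)
    rintro _ ⟨q, rfl⟩
    exact rankAt_le_ncard q F

/-- A property of placements holds generically if it is implied by the nonvanishing of some
nonzero polynomial in the coordinates. -/
def HoldsGenerically (Q : (V → Fin d → ℝ) → Prop) : Prop :=
  ∃ P : MvPolynomial (V × Fin d) ℝ, P ≠ 0 ∧
    ∀ p, MvPolynomial.eval (fun wi => p wi.1 wi.2) P ≠ 0 → Q p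

omit [DecidableEq V] [Fintype V] in
lemma HoldsGenerically.of_eval_ne_zero {Q : (V → Fin d → ℝ) → Prop}
    (P : MvPolynomial (V × Fin d) ℝ)
    (h : ∀ p, MvPolynomial.eval (fun wi => p wi.1 wi.2) P ≠ 0 → Q p) (p₀ : V → Fin d → ℝ)
    (h₀ : MvPolynomial.eval (fun wi => p₀ wi.1 wi.2) P ≠ 0) : HoldsGenerically Q :=
  ⟨P, fun h' => h₀ (by rw [h', map_zero]), h⟩

omit [DecidableEq V] [Fintype V] in
lemma HoldsGenerically.and {Q R : (V → Fin d → ℝ) → Prop} (hQ : HoldsGenerically Q)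
    (hR : HoldsGenerically R) : HoldsGenerically fun p => Q p ∧ R p := by
  obtain ⟨P, hP, hPQ⟩ := hQ
  obtain ⟨P', hP', hPR⟩ := hR
  refine ⟨P * P', mul_ne_zero hP hP', fun p hp => ?_⟩
  rw [map_mul] at hp
  exact ⟨hPQ p (left_ne_zero_of_mul hp), hPR p (right_ne_zero_of_mul hp)⟩

omit [DecidableEq V] [Fintype V] in
lemma HoldsGenerically.forall {ι : Type*} [Finite ι] {Q : ι → (V → Fin d → ℝ) → Prop}
    (hQ : ∀ i, HoldsGenerically (Q i)) : HoldsGenerically fun p => ∀ i, Q i p := by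
  have := Fintype.ofFinite ι
  choose P hP hPQ using hQ
  refine ⟨∏ i, P i, Finset.prod_ne_zero_iff.2 fun i _ => hP i, fun p hp i => hPQ i p ?_⟩
  rw [map_prod, Finset.prod_ne_zero_iff] at hp
  exact hp i (Finset.mem_univ i)

omit [DecidableEq V] [Fintype V] in
lemma HoldsGenerically.imp {c : Prop} {Q : (V → Fin d → ℝ) → Prop}
    (hQ : c → HoldsGenerically Q) : HoldsGenerically fun p => c → Q p := by
  by_cases hc : c
  · obtain ⟨P, hP, h⟩ := hQ hc
    exact ⟨P, hP, fun p hp _ => h p hp⟩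
  · exact ⟨1, one_ne_zero, fun _ _ h => absurd h hc⟩

omit [DecidableEq V] [Fintype V] in
lemma HoldsGenerically.exists {Q : (V → Fin d → ℝ) → Prop} (hQ : HoldsGenerically Q) :
    ∃ p, Q p := by
  obtain ⟨P, hP, h⟩ := hQ
  by_contra! hno
  refine hP (MvPolynomial.funext fun x => ?_)
  rw [map_zero]
  by_contra hx
  exact hno (fun v i => x (v, i)) (h _ hx)

omit [Fintype V] in
lemma exists_polynomial_eval_eq_row (e : Sym2 V) (wi : V × Fin d) :
    ∃ P : MvPolynomial (V × Fin d) ℝ, ∀ p : V → Fin d → ℝ,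
      MvPolynomial.eval (fun wi => p wi.1 wi.2) P = row p e wi := by
  induction e with
  | h u v =>
    refine ⟨if wi.1 = u then MvPolynomial.X (u, wi.2) - MvPolynomial.X (v, wi.2)
      else if wi.1 = v then MvPolynomial.X (v, wi.2) - MvPolynomial.X (u, wi.2) else 0,
      fun p => ?_⟩
    rw [row_mk, edgeVec]
    split_ifs <;> simp

lemma holdsGenerically_linearIndepOn {F : Set (Sym2 V)} (hF : RdIndep d F) :
    HoldsGenerically fun p : V → Fin d → ℝ => LinearIndepOn ℝ (row p) F := by
  classical
  obtain ⟨p₀, hp₀⟩ := rdIndep_iff.1 hF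
  choose P hP using exists_polynomial_eval_eq_row (V := V) (d := d)
  let M : Matrix F (V × Fin d) (MvPolynomial (V × Fin d) ℝ) := Matrix.of fun e wi => P e wi
  let A : (V → Fin d → ℝ) → Matrix F (V × Fin d) ℝ := fun p => Matrix.of fun e => row p e
  have hdet : ∀ p : V → Fin d → ℝ,
      MvPolynomial.eval (fun wi => p wi.1 wi.2) (M * M.transpose).det =
        (A p * (A p).transpose).det := by
    intro p
    have hM : M.map (MvPolynomial.eval fun wi => p wi.1 wi.2) = A p := by
      ext e wi
      exact hP e wi p
    rw [RingHom.map_det, RingHom.mapMatrix_apply, Matrix.map_mul, Matrix.transpose_map, hM]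
  refine HoldsGenerically.of_eval_ne_zero (M * M.transpose).det (fun p hp => ?_) p₀ ?_
  · rw [hdet] at hp
    have h1 : Function.Injective fun c => Matrix.vecMul c (A p * (A p).transpose) :=
      Matrix.vecMul_injective_of_isUnit ((Matrix.isUnit_iff_isUnit_det _).2 hp.isUnit)
    have h2 : Function.Injective fun c => Matrix.vecMul c (A p) := by
      intro c c' hcc
      refine h1 ?_
      simp only [← Matrix.vecMul_vecMul]
      exact congrArg (fun x => Matrix.vecMul x (A p).transpose) hcc
    exact Matrix.vecMul_injective_iff.1 h2
  · rw [hdet]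
    have hrank : (A p₀ * (A p₀).transpose).rank = Fintype.card F := by
      rw [Matrix.rank_self_mul_transpose]
      exact LinearIndependent.rank_matrix hp₀
    rw [← isUnit_iff_ne_zero, ← Matrix.isUnit_iff_isUnit_det,
      ← Matrix.linearIndependent_rows_iff_isUnit, linearIndependent_iff_card_eq_finrank_span]
    rw [← hrank, Matrix.rank_eq_finrank_span_row]
    rfl

end Rows

section General

variable [DecidableEq V]

/-- Twice the signed area of the triangle with vertices `p a`, `p b`, `p c`. -/
def area (p : V → Fin 2 → ℝ) (a b c : V) : ℝ :=
  (p b 0 - p a 0) * (p c 1 - p a 1) - (p b 1 - p a 1) * (p c 0 - p a 0)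

/-- A plane placement that realises all `ℛ₂`-independent sets simultaneously, with distinct
first coordinates and no three points on a line. -/
structure InGeneralPosition (p : V → Fin 2 → ℝ) : Prop where
  linearIndepOn : ∀ F : Set (Sym2 V), RdIndep 2 F → LinearIndepOn ℝ (row p) F
  fst_ne : ∀ a b, a ≠ b → p a 0 ≠ p b 0
  area_ne_zero : ∀ a b c, a ≠ b → a ≠ c → b ≠ c → area p a b c ≠ 0

lemma exists_inGeneralPosition [Fintype V] : ∃ p : V → Fin 2 → ℝ, InGeneralPosition p := by
  have h1 : HoldsGenerically fun p : V → Fin 2 → ℝ =>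
      ∀ F : Set (Sym2 V), RdIndep 2 F → LinearIndepOn ℝ (row p) F :=
    .forall fun F => .imp holdsGenerically_linearIndepOn
  have h2 : HoldsGenerically fun p : V → Fin 2 → ℝ => ∀ a b, a ≠ b → p a 0 ≠ p b 0 := by
    refine .forall fun a => .forall fun b => .imp fun hab => ?_
    refine .of_eval_ne_zero (.X (a, 0) - .X (b, 0)) (fun p hp => ?_)
      (fun v _ => if v = a then 1 else 0) (by simp [hab.symm])
    simpa [sub_eq_zero] using hp
  have h3 : HoldsGenerically fun p : V → Fin 2 → ℝ =>
      ∀ a b c, a ≠ b → a ≠ c → b ≠ c → area p a b c ≠ 0 := by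
    refine .forall fun a => .forall fun b => .forall fun c => .imp fun hab => .imp fun hac =>
      .imp fun hbc => ?_
    refine .of_eval_ne_zero ((.X (b, 0) - .X (a, 0)) * (.X (c, 1) - .X (a, 1)) -
      (.X (b, 1) - .X (a, 1)) * (.X (c, 0) - .X (a, 0))) (fun p hp => ?_)
      (fun v i => if v = b then (if i = 0 then 1 else 0) else
        if v = c then (if i = 1 then 1 else 0) else 0) (by simp [hab, hac, hbc.symm])
    simpa [area] using hp
  obtain ⟨p, hp1, hp2, hp3⟩ := (h1.and (h2.and h3)).exists
  exact ⟨p, hp1, hp2, hp3⟩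

lemma InGeneralPosition.rdIndep_iff [Fintype V] {p : V → Fin 2 → ℝ} (hp : InGeneralPosition p)
    {F : Set (Sym2 V)} : RdIndep 2 F ↔ LinearIndepOn ℝ (row p) F :=
  ⟨hp.linearIndepOn F, fun h => Rigidity.rdIndep_iff.2 ⟨p, h⟩⟩

end General

section Extensions

variable [DecidableEq V]

lemma row_mk_apply {d : ℕ} (p : V → Fin d → ℝ) (u v w : V) (i : Fin d) :
    row p s(u, v) (w, i) =
      ((if w = u then 1 else 0) - (if w = v then 1 else 0)) * (p u i - p v i) := by
  rw [row_mk, edgeVec]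
  split_ifs <;> simp_all

lemma row_apply_of_notMem {d : ℕ} (p : V → Fin d → ℝ) {e : Sym2 V} {w : V} (h : w ∉ e)
    (i : Fin d) : row p e (w, i) = 0 := by
  induction e with
  | h u v =>
    rw [Sym2.mem_iff, not_or] at h
    simp [row_mk_apply, h.1, h.2]

/-- The rank of a plane framework on `n ≥ 2` vertices is at most `2n - 3`. -/
lemma card_add_three_le [Fintype V] {p : V → Fin 2 → ℝ} (hp : ∀ a b, a ≠ b → p a 0 ≠ p b 0)
    {X : Finset V} (hX : 2 ≤ X.card) {F : Finset (Sym2 V)} (hFX : F ⊆ X.sym2)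
    (hF : LinearIndepOn ℝ (row p) (F : Set (Sym2 V))) : F.card + 3 ≤ 2 * X.card := by
  obtain ⟨a, ha, b, hb, hab⟩ := Finset.one_lt_card.1 hX
  let S : Finset (V × Fin 2) := (X ×ˢ Finset.univ) \ {(a, 0), (a, 1), (b, 1)}
  have hS : S.card + 3 = 2 * X.card := by
    have h3 : ({(a, 0), (a, 1), (b, 1)} : Finset (V × Fin 2)).card = 3 := by
      rw [Finset.card_eq_three]
      exact ⟨_, _, _, by simp, by simp, by simp [hab], rfl⟩
    have hsub : ({(a, 0), (a, 1), (b, 1)} : Finset (V × Fin 2)) ⊆ X ×ˢ Finset.univ := by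
      intro x hx
      simp only [Finset.mem_insert, Finset.mem_singleton] at hx
      rcases hx with rfl | rfl | rfl <;> simp [ha, hb]
    have : S.card + _ = _ := Finset.card_sdiff_add_card_eq_card hsub
    rw [h3, Finset.card_product, Finset.card_univ, Fintype.card_fin] at this
    omega
  let W : Submodule ℝ (V × Fin 2 → ℝ) :=
    { carrier := {x | (∀ w ∉ X, ∀ i, x (w, i) = 0) ∧ (∀ i, ∑ w, x (w, i) = 0) ∧
        ∑ w, (p w 0 * x (w, 1) - p w 1 * x (w, 0)) = 0}
      zero_mem' := by simp
      add_mem' := by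
        rintro x y ⟨h1, h2, h3⟩ ⟨h1', h2', h3'⟩
        refine ⟨fun w hw i => by simp [h1 w hw, h1' w hw],
          fun i => by simp [Finset.sum_add_distrib, h2, h2'], ?_⟩
        have := congrArg₂ (· + ·) h3 h3'
        simp only [← Finset.sum_add_distrib, add_zero] at this
        rw [← this]
        refine Finset.sum_congr rfl fun w _ => ?_
        simp only [Pi.add_apply]
        ring
      smul_mem' := by
        rintro c x ⟨h1, h2, h3⟩
        refine ⟨fun w hw i => by simp [h1 w hw],
          fun i => by simp [← Finset.mul_sum, h2], ?_⟩
        have := congrArg (c * ·) h3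
        simp only [Finset.mul_sum, mul_zero] at this
        rw [← this]
        refine Finset.sum_congr rfl fun w _ => ?_
        simp only [Pi.smul_apply, smul_eq_mul]
        ring }
  have hrow : Submodule.span ℝ (row p '' (F : Set (Sym2 V))) ≤ W := by
    rw [Submodule.span_le]
    rintro _ ⟨e, he, rfl⟩
    have heX := Finset.mem_sym2_iff.1 (hFX he)
    refine ⟨fun w hw i => row_apply_of_notMem p (fun h => hw (heX w h)) i, ?_, ?_⟩
    · induction e with
      | h u v => intro i; simp [row_mk_apply, ← Finset.sum_mul, Finset.sum_sub_distrib]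
    · induction e with
      | h u v =>
        simp only [row_mk_apply, mul_sub, sub_mul, ite_mul, mul_ite, one_mul, zero_mul, mul_zero,
          Finset.sum_sub_distrib, Finset.sum_ite_eq', Finset.mem_univ, if_true]
        ring
  let π : (V × Fin 2 → ℝ) →ₗ[ℝ] (S → ℝ) := LinearMap.funLeft ℝ ℝ Subtype.val
  have hker : ∀ x ∈ W, π x = 0 → x = 0 := by
    rintro x ⟨h1, h2, h3⟩ hx
    have hz : ∀ wi : V × Fin 2, wi ≠ (a, 0) → wi ≠ (a, 1) → wi ≠ (b, 1) → x wi = 0 := by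
      rintro ⟨w, i⟩ ha0 ha1 hb1
      by_cases hw : w ∈ X
      · exact congrFun hx ⟨(w, i), by simp_all [S]⟩
      · exact h1 w hw i
    have ha0 : x (a, 0) = 0 := by
      rw [← h2 0, Finset.sum_eq_single a] <;> simp +contextual [hz]
    have h2' := h2 1
    rw [Fintype.sum_eq_add a b hab fun w hw => hz _ (by simp) (by simp [hw.1]) (by simp [hw.2])]
      at h2'
    rw [Fintype.sum_eq_add a b hab fun w hw => by
      rw [hz (w, 0) (by simp [hw.1]) (by simp) (by simp),
        hz (w, 1) (by simp) (by simp [hw.1]) (by simp [hw.2])]; ring,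
      ha0, hz (b, 0) (by simp [hab.symm]) (by simp) (by simp)] at h3
    have hb1 : x (b, 1) = 0 := by
      have : (p b 0 - p a 0) * x (b, 1) = 0 := by linear_combination h3 - p a 0 * h2'
      exact (mul_eq_zero.1 this).resolve_left (sub_ne_zero.2 (hp b a hab.symm))
    have ha1 : x (a, 1) = 0 := by linarith
    funext wi
    by_cases e1 : wi = (a, 0)
    · rw [e1, ha0]; rfl
    by_cases e2 : wi = (a, 1)
    · rw [e2, ha1]; rfl
    by_cases e3 : wi = (b, 1)
    · rw [e3, hb1]; rfl
    exact hz wi e1 e2 e3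
  have hli : LinearIndepOn ℝ (π ∘ row p) (F : Set (Sym2 V)) := by
    refine hF.map_injOn π fun x hx y hy hxy => ?_
    rw [← sub_eq_zero]
    exact hker _ (W.sub_mem (hrow hx) (hrow hy)) (by rw [map_sub, hxy, sub_self])
  have hcard := LinearIndependent.fintype_card_le_finrank hli
  simp only [Module.finrank_fintype_fun_eq_card, Fintype.card_coe, Finset.coe_sort_coe] at hcard
  omega

lemma apply_eq_zero_of_mem_span {d : ℕ} {p : V → Fin d → ℝ} {F : Set (Sym2 V)} {v : V}
    (hF : ∀ e ∈ F, v ∉ e) {x : V × Fin d → ℝ} (hx : x ∈ Submodule.span ℝ (row p '' F))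
    (i : Fin d) : x (v, i) = 0 := by
  induction hx using Submodule.span_induction with
  | mem x hx => obtain ⟨e, he, rfl⟩ := hx; exact row_apply_of_notMem p (hF e he) i
  | zero => rfl
  | add x y _ _ hx hy => simp [hx, hy]
  | smul c x _ hx => simp [hx]

lemma LinearIndepOn.insert_edge {d : ℕ} {p : V → Fin d → ℝ} {F : Set (Sym2 V)} {v a : V}
    (hF : ∀ e ∈ F, v ∉ e) (hva : v ≠ a) (hp : p v ≠ p a) (h : LinearIndepOn ℝ (row p) F) :
    LinearIndepOn ℝ (row p) (insert s(v, a) F) := by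
  refine LinearIndepOn.insert h fun hmem => hp (funext fun i => ?_)
  have := apply_eq_zero_of_mem_span hF hmem i
  simpa [row_mk_apply, hva, sub_eq_zero] using this

lemma LinearIndepOn.insert_edge_edge {p : V → Fin 2 → ℝ} {F : Set (Sym2 V)} {v a b : V}
    (hF : ∀ e ∈ F, v ∉ e) (hva : v ≠ a) (hvb : v ≠ b) (hp : area p v a b ≠ 0)
    (h : LinearIndepOn ℝ (row p) F) :
    LinearIndepOn ℝ (row p) (insert s(v, b) (insert s(v, a) F)) := by
  have hpa : p v ≠ p a := fun h' => hp (by simp [area, h'])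
  refine LinearIndepOn.insert (LinearIndepOn.insert_edge hF hva hpa h) fun hmem => hp ?_
  rw [Set.image_insert_eq, Submodule.mem_span_insert] at hmem
  obtain ⟨c, z, hz, hcz⟩ := hmem
  have key : ∀ i, p v i - p b i = c * (p v i - p a i) := fun i => by
    have := congrFun hcz (v, i)
    simpa [row_mk_apply, hva, hvb, apply_eq_zero_of_mem_span hF hz i] using this
  have h0 := key 0
  have h1 := key 1
  unfold area
  linear_combination (p a 1 - p v 1) * h0 - (p a 0 - p v 0) * h1

variable [Fintype V]

lemma RdIndep.insert_edge {F : Set (Sym2 V)} {v a : V} (hF : ∀ e ∈ F, v ∉ e) (hva : v ≠ a)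
    (h : RdIndep 2 F) : RdIndep 2 (insert s(v, a) F) := by
  obtain ⟨p, hp⟩ := exists_inGeneralPosition (V := V)
  exact hp.rdIndep_iff.2 (LinearIndepOn.insert_edge hF hva
    (fun h' => hp.fst_ne v a hva (congrFun h' 0)) (hp.rdIndep_iff.1 h))

lemma RdIndep.insert_edge_edge {F : Set (Sym2 V)} {v a b : V} (hF : ∀ e ∈ F, v ∉ e)
    (hva : v ≠ a) (hvb : v ≠ b) (hab : a ≠ b) (h : RdIndep 2 F) :
    RdIndep 2 (insert s(v, b) (insert s(v, a) F)) := by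
  obtain ⟨p, hp⟩ := exists_inGeneralPosition (V := V)
  exact hp.rdIndep_iff.2 (LinearIndepOn.insert_edge_edge hF hva hvb
    (hp.area_ne_zero v a b hva hvb hab) (hp.rdIndep_iff.1 h))

/-- The `1`-extension (edge split) preserves independence. -/
lemma RdIndep.edge_split {F : Set (Sym2 V)} {v a b c : V} (hF : ∀ e ∈ F, v ∉ e)
    (hva : v ≠ a) (hvb : v ≠ b) (hvc : v ≠ c) (hab : a ≠ b) (hac : a ≠ c) (hbc : b ≠ c)
    (habF : s(a, b) ∉ F) (h : RdIndep 2 (insert s(a, b) F)) :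
    RdIndep 2 (insert s(v, b) (insert s(v, c) (insert s(v, a) F))) := by
  obtain ⟨p, hp⟩ := exists_inGeneralPosition (V := V)
  set q : V → Fin 2 → ℝ := Function.update p v fun i => (p a i + p b i) / 2 with hq
  have hqv : ∀ i, q v i = (p a i + p b i) / 2 := fun i => by simp [hq]
  have hqw : ∀ w, v ≠ w → q w = p w := fun w hw => by simp [hq, hw.symm]
  have hF' : ∀ e ∈ insert s(a, b) F, v ∉ e := by
    rintro e (rfl | he)
    · simp [hva, hvb]
    · exact hF e he
  have hrow : Set.EqOn (row p) (row q) (insert s(a, b) F) := by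
    intro e he
    have hv := hF' e he
    induction e with
    | h x y =>
      rw [Sym2.mem_iff, not_or] at hv
      funext ⟨w, i⟩
      rw [row_mk_apply, row_mk_apply, hqw x hv.1, hqw y hv.2]
  have hli : LinearIndepOn ℝ (row q) (insert s(a, b) F) := (hp.rdIndep_iff.1 h).congr hrow
  have harea : area q v a c ≠ 0 := by
    intro h0
    refine hp.area_ne_zero a b c hab hac hbc ?_
    unfold area at h0 ⊢
    rw [hqw a hva, hqw c hvc, hqv, hqv] at h0
    linear_combination -2 * h0
  have hli' := LinearIndepOn.insert_edge_edge hF' hva hvc harea hli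
  rw [Set.insert_comm _ s(a, b), Set.insert_comm _ s(a, b)] at hli'
  have hnot : s(a, b) ∉ insert s(v, c) (insert s(v, a) F) := by
    simp [habF, hva.symm, hvb.symm]
  rw [linearIndepOn_insert hnot] at hli'
  refine rdIndep_iff.2 ⟨q, hli'.1.insert fun hmem => hli'.2 ?_⟩
  have heq : row q s(a, b) = (2 : ℝ) • (row q s(v, a) + row q s(v, b)) := by
    funext ⟨w, i⟩
    simp only [Pi.smul_apply, Pi.add_apply, smul_eq_mul, row_mk_apply, hqv, hqw a hva, hqw b hvb]
    ring
  rw [heq]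
  exact Submodule.smul_mem _ _ (Submodule.add_mem _
    (Submodule.subset_span ⟨_, by simp, rfl⟩) hmem)

end Extensions

section Laman

variable [DecidableEq V]

/-- Laman's count: no loops, and every set of `n ≥ 2` vertices spans at most `2n - 3` edges. -/
structure IsSparse (F : Finset (Sym2 V)) : Prop where
  not_isDiag : ∀ e ∈ F, ¬ e.IsDiag
  card_add_three_le : ∀ X : Finset V, 2 ≤ X.card → (F ∩ X.sym2).card + 3 ≤ 2 * X.card

lemma IsSparse.mono {F F' : Finset (Sym2 V)} (hF : IsSparse F) (h : F' ⊆ F) : IsSparse F' :=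
  ⟨fun e he => hF.not_isDiag e (h he), fun X hX =>
    (Nat.add_le_add_right (Finset.card_le_card (Finset.inter_subset_inter_right h)) 3).trans
      (hF.card_add_three_le X hX)⟩

lemma inter_sym2_inter (F : Finset (Sym2 V)) (X Y : Finset V) :
    (F ∩ X.sym2) ∩ (F ∩ Y.sym2) = F ∩ (X ∩ Y).sym2 := by
  ext e
  simp only [Finset.mem_inter, Finset.mem_sym2_iff]
  grind

lemma IsSparse.inter_sym2_eq_empty {F : Finset (Sym2 V)} (hF : IsSparse F) {X : Finset V}
    (hX : X.card ≤ 1) : F ∩ X.sym2 = ∅ := by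
  refine Finset.eq_empty_of_forall_notMem fun e he => ?_
  rw [Finset.mem_inter, Finset.mem_sym2_iff] at he
  induction e with
  | h u v =>
    refine hF.not_isDiag _ he.1 ?_
    exact Finset.card_le_one.1 hX u (he.2 u (by simp)) v (he.2 v (by simp))

lemma IsSparse.tight_union {F : Finset (Sym2 V)} (hF : IsSparse F) {X Y : Finset V}
    (hX : 2 * X.card ≤ (F ∩ X.sym2).card + 3) (hY : 2 * Y.card ≤ (F ∩ Y.sym2).card + 3)
    (hXY : 2 ≤ (X ∩ Y).card) :
    2 * (X ∪ Y).card ≤ (F ∩ (X ∪ Y).sym2).card + 3 := by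
  have h1 := hF.card_add_three_le _ hXY
  have h2 := Finset.card_union_add_card_inter X Y
  have h3 := Finset.card_union_add_card_inter (F ∩ X.sym2) (F ∩ Y.sym2)
  rw [inter_sym2_inter] at h3
  have h4 : (F ∩ X.sym2 ∪ F ∩ Y.sym2).card ≤ (F ∩ (X ∪ Y).sym2).card := by
    refine Finset.card_le_card (Finset.union_subset ?_ ?_) <;>
      refine Finset.inter_subset_inter_left (Finset.sym2_mono ?_)
    exacts [Finset.subset_union_left, Finset.subset_union_right]
  omega

/-- Three tight sets pairwise containing two of three given points yield a tight set containing
all three points. -/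
lemma IsSparse.exists_tight_of_pairs {F : Finset (Sym2 V)} (hF : IsSparse F) {v a b c : V}
    {A B C : Finset V}
    (hA : 2 * A.card ≤ (F ∩ A.sym2).card + 3) (hB : 2 * B.card ≤ (F ∩ B.sym2).card + 3)
    (hC : 2 * C.card ≤ (F ∩ C.sym2).card + 3) (hvA : v ∉ A) (hvB : v ∉ B) (hvC : v ∉ C)
    (hbA : b ∈ A) (hcA : c ∈ A) (haB : a ∈ B) (hcB : c ∈ B) (haC : a ∈ C) (hbC : b ∈ C) :
    ∃ T : Finset V, v ∉ T ∧ a ∈ T ∧ b ∈ T ∧ c ∈ T ∧ 2 * T.card ≤ (F ∩ T.sym2).card + 3 := by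
  by_cases habc : a ∈ A
  · exact ⟨A, hvA, habc, hbA, hcA, hA⟩
  by_cases hAB : 2 ≤ (A ∩ B).card
  · exact ⟨A ∪ B, by simp [*], by simp [*], by simp [*], by simp [*], hF.tight_union hA hB hAB⟩
  by_cases hAC : 2 ≤ (A ∩ C).card
  · exact ⟨A ∪ C, by simp [*], by simp [*], by simp [*], by simp [*], hF.tight_union hA hC hAC⟩
  by_cases hBC : 2 ≤ (B ∩ C).card
  · exact ⟨B ∪ C, by simp [*], by simp [*], by simp [*], by simp [*], hF.tight_union hB hC hBC⟩
  refine ⟨A ∪ B ∪ C, by simp [*], by simp [*], by simp [*], by simp [*], ?_⟩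
  have dAB : Disjoint (F ∩ A.sym2) (F ∩ B.sym2) := by
    rw [Finset.disjoint_iff_inter_eq_empty, inter_sym2_inter]
    exact hF.inter_sym2_eq_empty (by omega)
  have dAC : Disjoint (F ∩ A.sym2) (F ∩ C.sym2) := by
    rw [Finset.disjoint_iff_inter_eq_empty, inter_sym2_inter]
    exact hF.inter_sym2_eq_empty (by omega)
  have dBC : Disjoint (F ∩ B.sym2) (F ∩ C.sym2) := by
    rw [Finset.disjoint_iff_inter_eq_empty, inter_sym2_inter]
    exact hF.inter_sym2_eq_empty (by omega)
  have hE : (F ∩ A.sym2 ∪ F ∩ B.sym2 ∪ F ∩ C.sym2).card ≤ (F ∩ (A ∪ B ∪ C).sym2).card := by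
    refine Finset.card_le_card (Finset.union_subset (Finset.union_subset ?_ ?_) ?_) <;>
      refine Finset.inter_subset_inter_left (Finset.sym2_mono fun x hx => ?_) <;> simp [hx]
  rw [Finset.card_union_of_disjoint (Finset.disjoint_union_left.2 ⟨dAC, dBC⟩),
    Finset.card_union_of_disjoint dAB] at hE
  have h1 := Finset.card_union_add_card_inter A B
  have h2 := Finset.card_union_add_card_inter (A ∪ B) C
  have h3 : 1 ≤ (A ∩ B).card := Finset.card_pos.2 ⟨c, by simp [*]⟩
  have h4 : 2 ≤ ((A ∪ B) ∩ C).card := by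
    refine Finset.one_lt_card.2 ⟨a, by simp [*], b, by simp [*], ?_⟩
    rintro rfl
    exact habc hbA
  omega

lemma exists_card_filter_mem [Fintype V] {F : Finset (Sym2 V)} (hF : IsSparse F)
    (hne : F.Nonempty) : ∃ v, 1 ≤ (F.filter (v ∈ ·)).card ∧ (F.filter (v ∈ ·)).card ≤ 3 := by
  by_contra! hno
  let X : Finset V := Finset.univ.filter fun v => ∃ e ∈ F, v ∈ e
  have hFX : F ∩ X.sym2 = F := by
    refine Finset.inter_eq_left.2 fun e he => Finset.mem_sym2_iff.2 fun v hv => ?_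
    simpa [X] using ⟨e, he, hv⟩
  have h1 : 2 ≤ X.card := by
    obtain ⟨e, he⟩ := hne
    by_contra! h
    have := hF.inter_sym2_eq_empty (X := X) (by omega)
    rw [hFX] at this
    simp [this] at he
  have h2 := hF.card_add_three_le X h1
  rw [hFX] at h2
  have h3 : X.card * 4 ≤ F.card * 2 := by
    refine Finset.card_mul_le_card_mul (fun v e => v ∈ e) (fun v hv => ?_) (fun e he => ?_)
    · obtain ⟨e, he, hve⟩ := (Finset.mem_filter.1 hv).2
      exact hno v (Finset.card_pos.2 ⟨e, by simp [he, hve]⟩)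
    · induction e with
      | h a b =>
        refine (Finset.card_le_card (t := {a, b}) fun w hw => ?_).trans Finset.card_le_two
        simpa [Finset.bipartiteBelow] using (Finset.mem_filter.1 hw).2
  omega

/-- Splitting off the edges at a vertex. -/
lemma exists_eq_union_image {F : Finset (Sym2 V)} (hF : ∀ e ∈ F, ¬ e.IsDiag) (v : V) :
    ∃ N : Finset V, v ∉ N ∧ N.card = (F.filter (v ∈ ·)).card ∧
      F = F.filter (v ∉ ·) ∪ N.image (fun w => s(v, w)) := by
  have key : ∃ N : Finset V, v ∉ N ∧ F.filter (v ∈ ·) = N.image (fun w => s(v, w)) := by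
    classical
    have hinj : Function.Injective fun w => s(v, w) := fun x y h => Sym2.congr_right.1 h
    refine ⟨(F.filter (v ∈ ·)).preimage (fun w => s(v, w)) hinj.injOn,
      ?_, ?_⟩
    · rw [Finset.mem_preimage]
      exact fun h => hF _ (Finset.mem_filter.1 h).1 rfl
    · rw [Finset.image_preimage]
      refine (Finset.filter_true_of_mem fun e he => ?_).symm
      obtain ⟨w, rfl⟩ := (Finset.mem_filter.1 he).2
      exact ⟨w, rfl⟩
  obtain ⟨N, hvN, hN⟩ := key
  refine ⟨N, hvN, ?_, ?_⟩
  · rw [hN, Finset.card_image_of_injective _ fun x y h => Sym2.congr_right.1 h]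
  · rw [← hN, Finset.union_comm, Finset.filter_union_filter_not_eq]

/-- If adding a pair to a sparse set destroys sparsity, the pair lies in a tight set. -/
lemma IsSparse.exists_tight {F : Finset (Sym2 V)} (hF : IsSparse F) {v a b : V}
    (hv : ∀ e ∈ F, v ∉ e) (hva : v ≠ a) (hvb : v ≠ b) (hab : a ≠ b)
    (h : s(a, b) ∈ F ∨ ¬ IsSparse (insert s(a, b) F)) :
    ∃ X : Finset V, v ∉ X ∧ a ∈ X ∧ b ∈ X ∧ 2 * X.card ≤ (F ∩ X.sym2).card + 3 := by
  rcases h with h | h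
  · refine ⟨{a, b}, by simp [hva, hvb], by simp, by simp, ?_⟩
    have : 1 ≤ (F ∩ ({a, b} : Finset V).sym2).card :=
      Finset.card_pos.2 ⟨s(a, b), by simp [h]⟩
    rw [Finset.card_pair hab]
    omega
  · by_contra! hno
    refine h ⟨fun e he => ?_, fun X hX => ?_⟩
    · rcases Finset.mem_insert.1 he with rfl | he
      · simpa using hab
      · exact hF.not_isDiag e he
    · by_cases hX' : s(a, b) ∈ X.sym2
      · rw [Finset.mk_mem_sym2_iff] at hX'
        have h1 := hno (X.erase v) (by simp) (by simp [hva.symm, hX'])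
          (by simp [hvb.symm, hX'])
        have h2 : F ∩ (X.erase v).sym2 = F ∩ X.sym2 := by
          ext e
          simp only [Finset.mem_inter, Finset.mem_sym2_iff, Finset.mem_erase]
          exact ⟨fun h => ⟨h.1, fun w hw => (h.2 w hw).2⟩,
            fun h => ⟨h.1, fun w hw => ⟨fun hwv => hv e h.1 (hwv ▸ hw), h.2 w hw⟩⟩⟩
        have h3 : (X.erase v).card ≤ X.card := Finset.card_le_card (Finset.erase_subset _ _)
        have h4 : (insert s(a, b) F ∩ X.sym2).card ≤ (F ∩ X.sym2).card + 1 := by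
          refine (Finset.card_le_card (t := insert s(a, b) (F ∩ X.sym2)) ?_).trans
            (Finset.card_insert_le _ _)
          grind
        rw [h2] at h1
        omega
      · rw [Finset.insert_inter_of_notMem hX']
        exact hF.card_add_three_le X hX

/-- **Laman's theorem** (sufficiency): sparse edge sets are independent. -/
theorem IsSparse.rdIndep [Fintype V] {F : Finset (Sym2 V)} (hF : IsSparse F) :
    RdIndep 2 (F : Set (Sym2 V)) := by
  induction hn : F.card using Nat.strong_induction_on generalizing F with
  | _ n ih =>
  subst hn
  rcases F.eq_empty_or_nonempty with rfl | hne
  · rw [Finset.coe_empty, rdIndep_iff]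
    exact ⟨0, linearIndepOn_empty _ _⟩
  obtain ⟨v, h1, h3⟩ := exists_card_filter_mem hF hne
  obtain ⟨N, hvN, hNcard, hN⟩ := exists_eq_union_image hF.not_isDiag v
  have hcard : (F.filter (v ∉ ·)).card + N.card = F.card := by
    rw [hNcard, add_comm]
    exact Finset.card_filter_add_card_filter_not _
  set F' := F.filter (v ∉ ·) with hF'
  rw [← hNcard] at h1 h3
  have hsub : F' ⊆ F := Finset.filter_subset _ _
  have hvF' : ∀ e ∈ (F' : Set (Sym2 V)), v ∉ e := fun e he => (Finset.mem_filter.1 he).2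
  have hind : RdIndep 2 (F' : Set (Sym2 V)) := ih _ (by omega) (hF.mono hsub) rfl
  rw [hN]
  obtain h | h | h : N.card = 1 ∨ N.card = 2 ∨ N.card = 3 := by omega
  · obtain ⟨a, rfl⟩ := Finset.card_eq_one.1 h
    have hva : v ≠ a := by simpa using hvN
    convert hind.insert_edge hvF' hva using 1
    ext e
    simp
  · obtain ⟨a, b, hab, rfl⟩ := Finset.card_eq_two.1 h
    obtain ⟨hva, hvb⟩ : v ≠ a ∧ v ≠ b := by simpa using hvN
    convert hind.insert_edge_edge hvF' hva hvb hab using 1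
    ext e
    simp [or_left_comm]
  · obtain ⟨a, b, c, hab, hac, hbc, rfl⟩ := Finset.card_eq_three.1 h
    obtain ⟨hva, hvb, hvc⟩ : v ≠ a ∧ v ≠ b ∧ v ≠ c := by simpa using hvN
    have split : ∀ {x y z : V}, v ≠ x → v ≠ y → v ≠ z → x ≠ y → x ≠ z → y ≠ z →
        (∀ e : Sym2 V, e = s(v, x) ∨ e = s(v, y) ∨ e = s(v, z) ↔
          e = s(v, a) ∨ e = s(v, b) ∨ e = s(v, c)) →
        s(x, y) ∉ F' → IsSparse (insert s(x, y) F') →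
        RdIndep 2 ((F' ∪ ({a, b, c} : Finset V).image fun w => s(v, w) : Finset (Sym2 V)) :
          Set (Sym2 V)) := by
      intro x y z hvx hvy hvz hxy hxz hyz hperm hmem hsp
      have := ih _ (by rw [Finset.card_insert_of_notMem hmem]; omega) hsp rfl
      rw [Finset.coe_insert] at this
      convert this.edge_split hvF' hvx hvy hvz hxy hxz hyz (by simpa using hmem) using 1
      ext e
      have h' : (e ∈ ({a, b, c} : Finset V).image fun w => s(v, w)) ↔
          e = s(v, a) ∨ e = s(v, b) ∨ e = s(v, c) := by simp
      rw [Finset.mem_coe, Finset.mem_union, h', ← hperm e]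
      simp only [Set.mem_insert_iff, Finset.mem_coe]
      clear * -
      tauto
    by_cases hC : s(a, b) ∈ F' ∨ ¬ IsSparse (insert s(a, b) F')
    swap
    · push Not at hC
      exact split hva hvb hvc hab hac hbc (by tauto) hC.1 hC.2
    by_cases hB : s(a, c) ∈ F' ∨ ¬ IsSparse (insert s(a, c) F')
    swap
    · push Not at hB
      exact split hva hvc hvb hac hab hbc.symm (by tauto) hB.1 hB.2
    by_cases hA : s(b, c) ∈ F' ∨ ¬ IsSparse (insert s(b, c) F')
    swap
    · push Not at hA
      exact split hvb hvc hva hbc hab.symm hac.symm (by tauto) hA.1 hA.2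
    exfalso
    have hs := hF.mono hsub
    obtain ⟨A, hvA, hbA, hcA, hA⟩ := hs.exists_tight hvF' hvb hvc hbc hA
    obtain ⟨B, hvB, haB, hcB, hB⟩ := hs.exists_tight hvF' hva hvc hac hB
    obtain ⟨C, hvC, haC, hbC, hC⟩ := hs.exists_tight hvF' hva hvb hab hC
    obtain ⟨T, hvT, haT, hbT, hcT, hT⟩ :=
      hs.exists_tight_of_pairs hA hB hC hvA hvB hvC hbA hcA haB hcB haC hbC
    have h4 : (insert v T).card = T.card + 1 := Finset.card_insert_of_notMem hvT
    have h5 : 1 ≤ T.card := Finset.card_pos.2 ⟨a, haT⟩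
    have h6 := hF.card_add_three_le (insert v T) (by omega)
    have h7 : (F' ∩ T.sym2 ∪ ({a, b, c} : Finset V).image fun w => s(v, w)).card ≤
        (F ∩ (insert v T).sym2).card := by
      refine Finset.card_le_card (Finset.union_subset
        (Finset.inter_subset_inter hsub (Finset.sym2_mono (Finset.subset_insert _ _))) ?_)
      refine Finset.subset_inter (by rw [hN]; exact Finset.subset_union_right) ?_
      intro e he
      obtain ⟨w, hw, rfl⟩ := Finset.mem_image.1 he
      rw [Finset.mk_mem_sym2_iff]
      refine ⟨Finset.mem_insert_self _ _, Finset.mem_insert_of_mem ?_⟩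
      simp only [Finset.mem_insert, Finset.mem_singleton] at hw
      rcases hw with rfl | rfl | rfl <;> assumption
    rw [Finset.card_union_of_disjoint, Finset.card_image_of_injective _
      fun x y h => Sym2.congr_right.1 h] at h7
    · omega
    · refine Finset.disjoint_left.2 fun e he he' => ?_
      obtain ⟨w, hw, rfl⟩ := Finset.mem_image.1 he'
      exact hvF' _ (Finset.mem_inter.1 he).1 (by simp)

end Laman

section Components

variable [DecidableEq V] [Fintype V]

lemma LinearIndepOn.ncard_le_of_image_subset_span {d : ℕ} {p : V → Fin d → ℝ}
    {T B : Set (Sym2 V)} (hT : LinearIndepOn ℝ (row p) T)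
    (h : row p '' T ⊆ Submodule.span ℝ (row p '' B)) : T.ncard ≤ B.ncard := by
  rw [← (linearIndepOn_row_iff p T).1 hT]
  refine le_trans ?_ (rankAt_le_ncard p B)
  rw [rankAt_eq_finrank, rankAt_eq_finrank, ← Set.image_eq_range, ← Set.image_eq_range]
  exact Submodule.finrank_mono (Submodule.span_le.2 h)

/-- The linear matroid of the rows of the rigidity matrix. -/
def rowMatroid {d : ℕ} (p : V → Fin d → ℝ) : Matroid (Sym2 V) :=
  (IndepMatroid.ofFinite (E := Set.univ) Set.finite_univ (LinearIndepOn ℝ (row p))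
    (linearIndepOn_empty _ _) (fun _ _ hJ hIJ => hJ.mono hIJ)
    (fun I J hI hJ hIJ => by
      by_contra! hno
      refine hIJ.not_ge (LinearIndepOn.ncard_le_of_image_subset_span hJ ?_)
      rintro _ ⟨e, he, rfl⟩
      by_cases heI : e ∈ I
      · exact Submodule.subset_span ⟨e, heI, rfl⟩
      · by_contra hspan
        exact hno e he heI (LinearIndepOn.insert hI hspan))
    fun I _ => Set.subset_univ I).matroid

lemma rowMatroid_indep_iff {d : ℕ} {p : V → Fin d → ℝ} {F : Set (Sym2 V)} :
    (rowMatroid p).Indep F ↔ LinearIndepOn ℝ (row p) F := Iff.rfl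

lemma InGeneralPosition.isCircuit_iff {p : V → Fin 2 → ℝ} (hp : InGeneralPosition p)
    {C : Set (Sym2 V)} : (rowMatroid p).IsCircuit C ↔ RdCircuit 2 C := by
  rw [Matroid.isCircuit_iff_forall_ssubset, RdCircuit, Matroid.Dep, rowMatroid_indep_iff,
    hp.rdIndep_iff, and_iff_left (show C ⊆ (rowMatroid p).E from Set.subset_univ C)]
  simp only [rowMatroid_indep_iff, hp.rdIndep_iff]

/-- Circuits of the plane rigidity matroid are rigid: the row of any pair of vertices of a
circuit is spanned by the rows of the circuit. -/
lemma InGeneralPosition.row_mem_span_of_rdCircuit {p : V → Fin 2 → ℝ}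
    (hp : InGeneralPosition p) {C : Set (Sym2 V)} (hC : RdCircuit 2 C)
    (hdiag : ∀ e ∈ C, ¬ e.IsDiag) {a b : V} (ha : a ∈ vertexSpan C) (hb : b ∈ vertexSpan C) :
    row p s(a, b) ∈ Submodule.span ℝ (row p '' C) := by
  classical
  lift C to Finset (Sym2 V) using Set.toFinite C
  have hX : ∃ X : Finset V, 2 ≤ X.card ∧ 2 * X.card < (C ∩ X.sym2).card + 3 := by
    by_contra! hno
    exact hC.1 (IsSparse.rdIndep ⟨hdiag, hno⟩)
  obtain ⟨X, hX2, hX⟩ := hX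
  have hCX : C ∩ X.sym2 = C := by
    by_contra hne
    have hss : ((C ∩ X.sym2 : Finset (Sym2 V)) : Set (Sym2 V)) ⊂ C :=
      Finset.coe_ssubset.2 (Finset.inter_subset_left.ssubset_of_ne hne)
    have := card_add_three_le hp.fst_ne hX2 Finset.inter_subset_right
      (hp.rdIndep_iff.1 (hC.2 _ hss))
    omega
  have hCX' : C ⊆ X.sym2 := Finset.inter_eq_left.1 hCX
  rw [hCX] at hX
  have hmem : ∀ {x}, x ∈ vertexSpan (C : Set (Sym2 V)) → x ∈ X := by
    rintro x ⟨e, he, hx⟩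
    exact Finset.mem_sym2_iff.1 (hCX' he) x hx
  by_contra hspan
  obtain ⟨e, he, hae⟩ := ha
  have hCe : LinearIndepOn ℝ (row p) ((C.erase e : Finset (Sym2 V)) : Set (Sym2 V)) :=
    hp.rdIndep_iff.1 (hC.2 _ (Finset.coe_ssubset.2 (Finset.erase_ssubset he)))
  have hspan' : row p s(a, b) ∉
      Submodule.span ℝ (row p '' ((C.erase e : Finset (Sym2 V)) : Set (Sym2 V))) := fun h =>
    hspan (Submodule.span_mono
      (Set.image_mono (Finset.coe_subset.2 (Finset.erase_subset e C))) h)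
  have hab : s(a, b) ∉ C.erase e := fun h => hspan' (Submodule.subset_span ⟨_, h, rfl⟩)
  have hins := LinearIndepOn.insert hCe hspan'
  rw [← Finset.coe_insert] at hins
  have := card_add_three_le hp.fst_ne hX2 (Finset.insert_subset
    (Finset.mk_mem_sym2_iff.2 ⟨hmem ⟨e, he, hae⟩, hmem hb⟩)
    ((Finset.erase_subset e C).trans hCX')) hins
  rw [Finset.card_insert_of_notMem hab, Finset.card_erase_add_one he] at this
  omega

/-- Joining every vertex of `W` to both ends of an edge `uv` gives an independent set. -/
lemma InGeneralPosition.exists_book {p : V → Fin 2 → ℝ} (hp : InGeneralPosition p) {u v : V}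
    (huv : u ≠ v) (W : Finset V) (hu : u ∉ W) (hv : v ∉ W) :
    ∃ T : Set (Sym2 V), LinearIndepOn ℝ (row p) T ∧ T.ncard = 2 * W.card + 1 ∧
      ∀ e ∈ T, e = s(u, v) ∨ ∃ w ∈ W, e = s(w, u) ∨ e = s(w, v) := by
  induction W using Finset.induction_on with
  | empty =>
    refine ⟨{s(u, v)}, ?_, by simp, by simp⟩
    have := LinearIndepOn.insert_edge (p := p) (F := ∅) (v := u) (a := v) (by simp) huv
      (fun h => hp.fst_ne u v huv (congrFun h 0)) (linearIndepOn_empty _ _)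
    simpa using this
  | insert w W hw ih =>
    simp only [Finset.mem_insert, not_or] at hu hv
    obtain ⟨T, hT, hcard, hTW⟩ := ih hu.2 hv.2
    have hwT : ∀ e ∈ T, w ∉ e := by
      intro e he hwe
      rcases hTW e he with rfl | ⟨x, hx, rfl | rfl⟩ <;> rw [Sym2.mem_iff] at hwe <;> grind
    refine ⟨insert s(w, v) (insert s(w, u) T), LinearIndepOn.insert_edge_edge hwT
      (Ne.symm hu.1) (Ne.symm hv.1)
      (hp.area_ne_zero w u v (Ne.symm hu.1) (Ne.symm hv.1) huv) hT, ?_, ?_⟩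
    · have h1 : s(w, u) ∉ T := fun h => hwT _ h (by simp)
      have h2 : s(w, v) ∉ insert s(w, u) T := by
        rintro (h | h)
        · exact huv.symm (Sym2.congr_right.1 h)
        · exact hwT _ h (by simp)
      rw [Set.ncard_insert_of_notMem h2, Set.ncard_insert_of_notMem h1, hcard,
        Finset.card_insert_of_notMem hw]
      ring
    · rintro e (rfl | rfl | he)
      · exact Or.inr ⟨w, by simp, Or.inr rfl⟩
      · exact Or.inr ⟨w, by simp, Or.inl rfl⟩
      · rcases hTW e he with h | ⟨x, hx, h⟩
        · exact Or.inl h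
        · exact Or.inr ⟨x, by simp [hx], h⟩

variable {G : SimpleGraph V} {F F' : Set (Sym2 V)}

omit [Fintype V] in
lemma IsRdComponent.subset_edgeSet {d : ℕ} (hF : IsRdComponent d G F) : F ⊆ G.edgeSet := by
  obtain ⟨e, -, rfl⟩ := hF
  exact fun f hf => hf.1

omit [Fintype V] in
lemma exists_isRdComponent_mem {d : ℕ} {e : Sym2 V} (he : e ∈ G.edgeSet) :
    ∃ F, IsRdComponent d G F ∧ e ∈ F :=
  ⟨_, ⟨e, he, rfl⟩, he, Or.inl rfl⟩

lemma IsRdComponent.subset_of_rdCircuitOf (hF : IsRdComponent 2 G F) {C : Set (Sym2 V)}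
    (hC : RdCircuitOf 2 G C) {e : Sym2 V} (heC : e ∈ C) (heF : e ∈ F) : C ⊆ F := by
  obtain ⟨p, hp⟩ := exists_inGeneralPosition (V := V)
  obtain ⟨e₀, -, rfl⟩ := hF
  intro f hf
  refine ⟨hC.1 hf, Or.inr ?_⟩
  obtain ⟨-, rfl | ⟨C', hC', he₀, he⟩⟩ := heF
  · exact ⟨C, hC, heC, hf⟩
  · obtain ⟨D, hD, hDC, h⟩ := exists_isCircuit_mem_mem (hp.isCircuit_iff.2 hC'.2)
      (hp.isCircuit_iff.2 hC.2) he₀ hf ⟨e, he, heC⟩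
    exact ⟨D, ⟨hD.trans (Set.union_subset hC'.1 hC.1), hp.isCircuit_iff.1 hDC⟩, h⟩

lemma IsRdComponent.eq_of_mem_of_mem (hF : IsRdComponent 2 G F) (hF' : IsRdComponent 2 G F')
    {f : Sym2 V} (hf : f ∈ F) (hf' : f ∈ F') : F = F' := by
  have key : ∀ {F F' : Set (Sym2 V)}, IsRdComponent 2 G F → IsRdComponent 2 G F' → f ∈ F →
      f ∈ F' → F ⊆ F' := by
    rintro _ F' ⟨e, -, rfl⟩ hF' ⟨-, hf⟩ hf' g ⟨-, hg⟩
    have he : e ∈ F' := by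
      rcases hf with rfl | ⟨C, hC, heC, hfC⟩
      · exact hf'
      · exact hF'.subset_of_rdCircuitOf hC hfC hf' heC
    rcases hg with rfl | ⟨C, hC, heC, hgC⟩
    · exact he
    · exact hF'.subset_of_rdCircuitOf hC heC he hgC
  exact (key hF hF' hf hf').antisymm (key hF' hF hf' hf)

/-- A component on `n` vertices contains an independent set of `2n - 3` edges. -/
lemma InGeneralPosition.exists_linearIndepOn_subset_component {p : V → Fin 2 → ℝ}
    (hp : InGeneralPosition p) (hF : IsRdComponent 2 G F) :
    ∃ B : Finset (Sym2 V), (B : Set (Sym2 V)) ⊆ F ∧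
      LinearIndepOn ℝ (row p) (B : Set (Sym2 V)) ∧ 2 ≤ (vertexSpan F).ncard ∧
      2 * (vertexSpan F).ncard ≤ B.card + 3 := by
  classical
  have hFG := hF.subset_edgeSet
  have hF' := hF
  obtain ⟨e, heG, hFe⟩ := hF'
  induction e with
  | h u v =>
  have huv : u ≠ v := (SimpleGraph.mem_edgeSet G).1 heG |>.ne
  have heF : s(u, v) ∈ F := by
    rw [hFe]
    exact ⟨heG, Or.inl rfl⟩
  obtain ⟨B, hBF, -, hFB, hB⟩ :=
    exists_linearIndepOn_extension (linearIndepOn_empty ℝ (row p)) (Set.empty_subset F)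
  lift B to Finset (Sym2 V) using Set.toFinite B
  have hspan : ∀ w ∈ vertexSpan F, w ≠ u → w ≠ v →
      row p s(w, u) ∈ Submodule.span ℝ (row p '' (B : Set (Sym2 V))) ∧
      row p s(w, v) ∈ Submodule.span ℝ (row p '' (B : Set (Sym2 V))) := by
    rintro w ⟨f, hf, hwf⟩ hwu hwv
    have hf' := hf
    rw [hFe] at hf'
    obtain ⟨-, rfl | ⟨C, hC, heC, hfC⟩⟩ := hf'
    · rw [Sym2.mem_iff] at hwf
      tauto
    · have hCB : Submodule.span ℝ (row p '' C) ≤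
          Submodule.span ℝ (row p '' (B : Set (Sym2 V))) :=
        Submodule.span_le.2 ((Set.image_mono (hF.subset_of_rdCircuitOf hC heC heF)).trans hFB)
      have hd : ∀ e ∈ C, ¬ e.IsDiag := fun e he => G.not_isDiag_of_mem_edgeSet (hC.1 he)
      exact ⟨hCB (hp.row_mem_span_of_rdCircuit hC.2 hd ⟨f, hfC, hwf⟩ ⟨_, heC, by simp⟩),
        hCB (hp.row_mem_span_of_rdCircuit hC.2 hd ⟨f, hfC, hwf⟩ ⟨_, heC, by simp⟩)⟩
  let W : Finset V := (Set.toFinite (vertexSpan F)).toFinset \ {u, v}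
  have hW : W.card + 2 = (vertexSpan F).ncard := by
    rw [Set.ncard_eq_toFinset_card _ (Set.toFinite _), ← Finset.card_pair huv]
    refine Finset.card_sdiff_add_card_eq_card ?_
    have hu : u ∈ vertexSpan F := ⟨_, heF, by simp⟩
    have hv : v ∈ vertexSpan F := ⟨_, heF, by simp⟩
    simp [Set.insert_subset_iff, hu, hv]
  obtain ⟨T, hT, hTcard, hTW⟩ := hp.exists_book huv W (by simp [W]) (by simp [W])
  have hTB : T.ncard ≤ (B : Set (Sym2 V)).ncard := by
    refine LinearIndepOn.ncard_le_of_image_subset_span hT ?_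
    rintro _ ⟨e, he, rfl⟩
    rcases hTW e he with rfl | ⟨w, hw, h⟩
    · exact hFB ⟨_, heF, rfl⟩
    · simp only [W, Finset.mem_sdiff, Set.Finite.mem_toFinset, Finset.mem_insert,
        Finset.mem_singleton, not_or] at hw
      obtain ⟨h1, h2⟩ := hspan w hw.1 hw.2.1 hw.2.2
      rcases h with rfl | rfl
      exacts [h1, h2]
  rw [Set.ncard_coe_finset] at hTB
  exact ⟨B, hBF, hB, by omega, by omega⟩

/-- Independent subsets of distinct components have independent union. -/
lemma InGeneralPosition.linearIndepOn_biUnion {p : V → Fin 2 → ℝ} (hp : InGeneralPosition p)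
    {S : Set (Set (Sym2 V))} (hS : ∀ F ∈ S, IsRdComponent 2 G F)
    {B : Set (Sym2 V) → Set (Sym2 V)} (hBF : ∀ F ∈ S, B F ⊆ F)
    (hB : ∀ F ∈ S, LinearIndepOn ℝ (row p) (B F)) :
    LinearIndepOn ℝ (row p) (⋃ F ∈ S, B F) := by
  rw [← rowMatroid_indep_iff]
  by_contra hdep
  obtain ⟨C, hCB, hC⟩ := Matroid.Dep.exists_isCircuit_subset
    (M := rowMatroid p) ⟨hdep, Set.subset_univ _⟩
  have hCG : RdCircuitOf 2 G C := by
    refine ⟨fun e he => ?_, hp.isCircuit_iff.1 hC⟩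
    obtain ⟨F, hF, he⟩ := Set.mem_iUnion₂.1 (hCB he)
    exact (hS F hF).subset_edgeSet (hBF F hF he)
  obtain ⟨e, he⟩ := hC.nonempty
  obtain ⟨F, hF, heF⟩ := Set.mem_iUnion₂.1 (hCB he)
  have hCF := (hS F hF).subset_of_rdCircuitOf hCG he (hBF F hF heF)
  refine hC.not_indep (rowMatroid_indep_iff.2 ((hB F hF).mono fun f hf => ?_))
  obtain ⟨F', hF', hfF'⟩ := Set.mem_iUnion₂.1 (hCB hf)
  rwa [(hS F hF).eq_of_mem_of_mem (hS F' hF') (hCF hf) (hBF F' hF' hfF')]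

end Components

/-- A graph with at least three `ℛ₂`-components has at least three
`ℛ₂`-components with at most two vertices of attachment. -/
theorem three_components_few_attachments {V : Type*} [Fintype V] [DecidableEq V]
    (G : SimpleGraph V)
    (h : 3 ≤ {F : Set (Sym2 V) | IsRdComponent 2 G F}.ncard) :
    3 ≤ {F : Set (Sym2 V) | IsRdComponent 2 G F ∧
      {a ∈ vertexSpan F | ∃ w, w ∉ vertexSpan F ∧ G.Adj a w}.ncard ≤ 2}.ncard := by
  classical
  obtain ⟨p, hp⟩ := exists_inGeneralPosition (V := V)
  let I : Finset (Set (Sym2 V)) := {F | IsRdComponent 2 G F}.toFinite.toFinset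
  let W : Set (Sym2 V) → Finset V := fun F => (vertexSpan F).toFinite.toFinset
  have hI : ∀ {F}, F ∈ I ↔ IsRdComponent 2 G F := by simp [I]
  have hWmem : ∀ {F x}, x ∈ W F ↔ x ∈ vertexSpan F := by simp [W]
  have hWcard : ∀ F, (W F).card = (vertexSpan F).ncard := fun F =>
    (Set.ncard_eq_toFinset_card _ _).symm
  choose! B hBF hB hF2 hBcard using fun F (hF : IsRdComponent 2 G F) =>
    hp.exists_linearIndepOn_subset_component hF
  have hcount : ∀ S ⊆ I, S.Nonempty →
      ∑ F ∈ S, (2 * ((W F).card : ℤ) - 3) ≤ 2 * ((S.biUnion W).card : ℤ) - 3 := by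
    intro S hSI hS
    have hSc : ∀ F ∈ S, IsRdComponent 2 G F := fun F hF => hI.1 (hSI hF)
    have hdisj : (S : Set (Set (Sym2 V))).PairwiseDisjoint B := by
      refine fun F hF F' hF' hne => Finset.disjoint_left.2 fun e he he' => hne ?_
      exact (hSc F hF).eq_of_mem_of_mem (hSc F' hF') (hBF F (hSc F hF) he)
        (hBF F' (hSc F' hF') he')
    have hind : LinearIndepOn ℝ (row p) ((S.biUnion B : Finset (Sym2 V)) : Set (Sym2 V)) := by
      rw [Finset.coe_biUnion]
      exact hp.linearIndepOn_biUnion (S := (S : Set (Set (Sym2 V)))) hSc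
        (B := fun F => (B F : Set (Sym2 V)))
        (fun F hF => hBF F (hSc F hF)) (fun F hF => hB F (hSc F hF))
    have hsub : S.biUnion B ⊆ (S.biUnion W).sym2 := by
      intro e he
      obtain ⟨F, hF, heF⟩ := Finset.mem_biUnion.1 he
      exact Finset.mem_sym2_iff.2 fun x hx => Finset.mem_biUnion.2
        ⟨F, hF, hWmem.2 ⟨e, hBF F (hSc F hF) heF, hx⟩⟩
    have htwo : 2 ≤ (S.biUnion W).card := by
      obtain ⟨F, hF⟩ := hS
      refine le_trans ?_ (Finset.card_le_card (Finset.subset_biUnion_of_mem W hF))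
      rw [hWcard]
      exact hF2 F (hSc F hF)
    have h1 := card_add_three_le hp.fst_ne htwo hsub hind
    rw [Finset.card_biUnion hdisj] at h1
    have h2 : ∑ F ∈ S, (2 * ((W F).card : ℤ) - 3) ≤ ∑ F ∈ S, ((B F).card : ℤ) := by
      refine Finset.sum_le_sum fun F hF => ?_
      have := hBcard F (hSc F hF)
      rw [← hWcard] at this
      omega
    rw [← Nat.cast_sum] at h2
    omega
  have hIcard : 3 ≤ I.card := by
    rwa [Set.ncard_eq_toFinset_card _ (Set.toFinite _)] at h
  refine (three_le_card_filter_sharedVerts I W hIcard hcount).trans ?_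
  rw [← Set.ncard_coe_finset]
  refine Set.ncard_le_ncard (fun F hF => ?_) (Set.toFinite _)
  rw [Finset.mem_coe, Finset.mem_filter, hI] at hF
  refine ⟨hF.1, le_trans ?_ hF.2⟩
  rw [← Set.ncard_coe_finset]
  refine Set.ncard_le_ncard (fun a ha => ?_) (Set.toFinite _)
  obtain ⟨haF, w, hw, haw⟩ := ha
  obtain ⟨F', hF', he⟩ := exists_isRdComponent_mem (d := 2) ((SimpleGraph.mem_edgeSet G).2 haw)
  refine Finset.mem_coe.2 (Finset.mem_filter.2 ⟨hWmem.2 haF, F', hI.2 hF', ?_,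
    hWmem.2 ⟨_, he, by simp⟩⟩)
  rintro rfl
  exact hw ⟨_, he, by simp⟩

end Rigidity
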